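/- Let 𝒞 be a triangulated category with a proper class ξ of triangles and enough ξ-projectives, A ∈ 𝒞, and n ≥ 0. Then ξ-Gpd(A) ≤ n if and only if for every 0 ≤ i ≤ n there is a ξ-exact sequence 0 → Pₙ → ⋯ → P_{i+1} → G → P_{i−1} → ⋯ → P₀ → A → 0 with P_j ξ-projective for all j ≠ i and G ∈ 𝒢𝒫(ξ). -/

import Mathlib

open CategoryTheory CategoryTheory.Limits CategoryTheory.Pretriangulated

namespace GorensteinTriangulated

variable {C : Type*} [Category C] [HasZeroObject C] [HasShift C ℤ] [Preadditive C]
  [∀ n : ℤ, (shiftFunctor C n).Additive] [Pretriangulated C]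

/-- A triangle `A ⟶ B ⟶ C ⟶ ΣA` is split if it is isomorphic to the triangle
`A ⟶ A ⊞ C ⟶ C ⟶ ΣA` with structure maps `(1 0)`, `(0 1)ᵀ` and `0`. -/
def IsSplitTriangle (T : Triangle C) : Prop :=
  Nonempty (T ≅ Triangle.mk (biprod.inl : T.obj₁ ⟶ T.obj₁ ⊞ T.obj₃) biprod.snd
    (0 : T.obj₃ ⟶ T.obj₁⟦(1 : ℤ)⟧))

/-- The triangle `T` becomes a short exact sequence after applying `Hom(Q, -)`. -/
def CoExact (T : Triangle C) (Q : C) : Prop :=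
  Function.Injective (fun φ : Q ⟶ T.obj₁ => φ ≫ T.mor₁) ∧
  (∀ φ : Q ⟶ T.obj₂, φ ≫ T.mor₂ = 0 → ∃ ψ : Q ⟶ T.obj₁, φ = ψ ≫ T.mor₁) ∧
  Function.Surjective (fun φ : Q ⟶ T.obj₂ => φ ≫ T.mor₂)

/-- The triangle `T` becomes a short exact sequence after applying `Hom(-, Q)`. -/
def ContraExact (T : Triangle C) (Q : C) : Prop :=
  Function.Injective (fun φ : T.obj₃ ⟶ Q => T.mor₂ ≫ φ) ∧
  (∀ φ : T.obj₂ ⟶ Q, T.mor₁ ≫ φ = 0 → ∃ ψ : T.obj₃ ⟶ Q, φ = T.mor₂ ≫ ψ) ∧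
  Function.Surjective (fun φ : T.obj₂ ⟶ Q => T.mor₁ ≫ φ)

/-- Saturation of a class of triangles with respect to base change: in a base change
diagram, if the third vertical triangle and the second horizontal triangle are in `S`,
then the original triangle is in `S`. -/
def SaturatedBase (S : Set (Triangle C)) : Prop :=
  ∀ T ∈ (distinguishedTriangles : Set (Triangle C)),
    ∀ (M G E : C) (α : M ⟶ G) (δ : M ⟶ E) (f' : T.obj₁ ⟶ G) (g' : G ⟶ E)
      (h' : E ⟶ T.obj₁⟦(1 : ℤ)⟧) (β : G ⟶ T.obj₂) (ε : E ⟶ T.obj₃)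
      (γ : T.obj₂ ⟶ M⟦(1 : ℤ)⟧) (ζ : T.obj₃ ⟶ M⟦(1 : ℤ)⟧),
      Triangle.mk α β γ ∈ (distinguishedTriangles : Set (Triangle C)) →
      Triangle.mk f' g' h' ∈ S → Triangle.mk δ ε ζ ∈ S →
      α ≫ g' = δ → f' ≫ β = T.mor₁ → g' ≫ ε = β ≫ T.mor₂ → h' = ε ≫ T.mor₃ →
      T.mor₂ ≫ ζ = γ → T ∈ S

/-- Saturation of a class of triangles with respect to cobase change: in a cobase change
diagram, if the second vertical triangle and the third horizontal triangle are in `S`,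
then the original triangle is in `S`. -/
def SaturatedCobase (S : Set (Triangle C)) : Prop :=
  ∀ T ∈ (distinguishedTriangles : Set (Triangle C)),
    ∀ (N D F : C) (ζ : N ⟶ T.obj₁) (δ : N ⟶ T.obj₂) (α : T.obj₁ ⟶ D) (β : T.obj₂ ⟶ F)
      (f' : D ⟶ F) (g' : F ⟶ T.obj₃) (h' : T.obj₃ ⟶ D⟦(1 : ℤ)⟧)
      (η : D ⟶ N⟦(1 : ℤ)⟧) (υ : F ⟶ N⟦(1 : ℤ)⟧),
      Triangle.mk ζ α η ∈ (distinguishedTriangles : Set (Triangle C)) →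
      Triangle.mk δ β υ ∈ S → Triangle.mk f' g' h' ∈ S →
      ζ ≫ T.mor₁ = δ → T.mor₁ ≫ β = α ≫ f' → T.mor₂ = β ≫ g' →
      T.mor₃ ≫ (shiftFunctor C (1 : ℤ)).map α = h' → f' ≫ υ = η → T ∈ S

/-- A proper class of triangles in the sense of Beligiannis. -/
structure IsProperClass (S : Set (Triangle C)) : Prop where
  subset_dist : S ⊆ (distinguishedTriangles : Set (Triangle C))
  split_mem : ∀ T : Triangle C, T ∈ (distinguishedTriangles : Set (Triangle C)) →
    IsSplitTriangle T → T ∈ S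
  iso_closed : ∀ T₁ T₂ : Triangle C, Nonempty (T₁ ≅ T₂) → T₁ ∈ S → T₂ ∈ S
  sum_closed : ∀ T₁ ∈ S, ∀ T₂ ∈ S, ∀ T ∈ (distinguishedTriangles : Set (Triangle C)),
    Nonempty (T.obj₁ ≅ T₁.obj₁ ⊞ T₂.obj₁) →
    (∀ e₁ : T.obj₁ ≅ T₁.obj₁ ⊞ T₂.obj₁, ∀ e₂ : T.obj₂ ≅ T₁.obj₂ ⊞ T₂.obj₂,
      ∀ e₃ : T.obj₃ ≅ T₁.obj₃ ⊞ T₂.obj₃,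
      T.mor₁ = e₁.hom ≫ biprod.map T₁.mor₁ T₂.mor₁ ≫ e₂.inv →
      T.mor₂ = e₂.hom ≫ biprod.map T₁.mor₂ T₂.mor₂ ≫ e₃.inv →
      T.mor₃ = e₃.hom ≫ biprod.desc
        (T₁.mor₃ ≫ (shiftFunctor C (1 : ℤ)).map (biprod.inl ≫ e₁.inv))
        (T₂.mor₃ ≫ (shiftFunctor C (1 : ℤ)).map (biprod.inr ≫ e₁.inv)) → T ∈ S)
  susp_closed : ∀ T ∈ S, ∀ i : ℤ, (Triangle.shiftFunctor C i).obj T ∈ S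
  saturated : SaturatedBase S
  base_change : ∀ T ∈ S, ∀ {E : C} (ε : E ⟶ T.obj₃),
    ∃ (G : C) (f' : T.obj₁ ⟶ G) (g' : G ⟶ E) (h' : E ⟶ T.obj₁⟦(1 : ℤ)⟧) (β : G ⟶ T.obj₂),
      Triangle.mk f' g' h' ∈ S ∧ f' ≫ β = T.mor₁ ∧ g' ≫ ε = β ≫ T.mor₂ ∧ h' = ε ≫ T.mor₃
  cobase_change : ∀ T ∈ S, ∀ {D : C} (α : T.obj₁ ⟶ D),
    ∃ (F : C) (f' : D ⟶ F) (g' : F ⟶ T.obj₃) (h' : T.obj₃ ⟶ D⟦(1 : ℤ)⟧) (β : T.obj₂ ⟶ F),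
      Triangle.mk f' g' h' ∈ S ∧ T.mor₁ ≫ β = α ≫ f' ∧ T.mor₂ = β ≫ g' ∧
      T.mor₃ ≫ (shiftFunctor C (1 : ℤ)).map α = h'

/-- `P` is a `ξ`-projective object. -/
def XiProjective (S : Set (Triangle C)) (P : C) : Prop :=
  ∀ T ∈ S, CoExact T P

/-- `𝒞` has enough `ξ`-projectives. -/
def HasEnoughXiProjectives (S : Set (Triangle C)) : Prop :=
  ∀ A : C, ∃ (K P : C) (f : K ⟶ P) (g : P ⟶ A) (h : A ⟶ K⟦(1 : ℤ)⟧),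
    XiProjective S P ∧ Triangle.mk f g h ∈ S

/-- The objects admitting a complete resolution by triangles in `S` with middle terms in
`X` which are `Hom(-, Y)`-exact; `GClass S X X` is the Gorenstein category `𝒢(X)` and
`GClass S (XiProjective S) (XiProjective S)` is the class of `ξ`-Gorenstein projectives. -/
def GClass (S : Set (Triangle C)) (X Y : C → Prop) (A : C) : Prop :=
  ∃ (K P : ℤ → C) (f : ∀ n : ℤ, K (n + 1) ⟶ P n) (g : ∀ n : ℤ, P n ⟶ K n)
    (h : ∀ n : ℤ, K n ⟶ (K (n + 1))⟦(1 : ℤ)⟧),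
    K 0 = A ∧ ∀ n : ℤ, X (P n) ∧ Triangle.mk (f n) (g n) (h n) ∈ S ∧
      ∀ Q : C, Y Q → ContraExact (Triangle.mk (f n) (g n) (h n)) Q

/-- `ξ`-Gorenstein projective objects. -/
def GProjective (S : Set (Triangle C)) (A : C) : Prop :=
  GClass S (XiProjective S) (XiProjective S) A

/-- A `ξ`-exact resolution `⋯ → X₁ → X₀ → A → 0` with terms satisfying `X`, which is
`Hom(-, Q)`-exact for every `Q` satisfying `Y`. -/
def HasResolution (S : Set (Triangle C)) (X Y : C → Prop) (A : C) : Prop :=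
  ∃ (K G : ℕ → C) (f : ∀ n : ℕ, K (n + 1) ⟶ G n) (g : ∀ n : ℕ, G n ⟶ K n)
    (h : ∀ n : ℕ, K n ⟶ (K (n + 1))⟦(1 : ℤ)⟧),
    K 0 = A ∧ ∀ n : ℕ, X (G n) ∧ Triangle.mk (f n) (g n) (h n) ∈ S ∧
      ∀ Q : C, Y Q → ContraExact (Triangle.mk (f n) (g n) (h n)) Q

/-- A `ξ`-exact coresolution `0 → A → X⁰ → X¹ → ⋯` with terms satisfying `X`, which is
`Hom(-, Q)`-exact for every `Q` satisfying `Y`. -/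
def HasCoresolution (S : Set (Triangle C)) (X Y : C → Prop) (A : C) : Prop :=
  ∃ (K G : ℕ → C) (f : ∀ n : ℕ, K n ⟶ G n) (g : ∀ n : ℕ, G n ⟶ K (n + 1))
    (h : ∀ n : ℕ, K (n + 1) ⟶ (K n)⟦(1 : ℤ)⟧),
    K 0 = A ∧ ∀ n : ℕ, X (G n) ∧ Triangle.mk (f n) (g n) (h n) ∈ S ∧
      ∀ Q : C, Y Q → ContraExact (Triangle.mk (f n) (g n) (h n)) Q

/-- A finite `ξ`-exact sequence `0 → Gₙ → ⋯ → G₀ → A → 0` where the `j`-th term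
satisfies the predicate `X j`. -/
def FiniteRes (S : Set (Triangle C)) (n : ℕ) (X : ℕ → C → Prop) (A : C) : Prop :=
  ∃ (K G : ℕ → C) (f : ∀ j : ℕ, K (j + 1) ⟶ G j) (g : ∀ j : ℕ, G j ⟶ K j)
    (h : ∀ j : ℕ, K j ⟶ (K (j + 1))⟦(1 : ℤ)⟧),
    K 0 = A ∧ IsZero (K (n + 1)) ∧
    ∀ j ≤ n, X j (G j) ∧ Triangle.mk (f j) (g j) (h j) ∈ S

/-- `ξ`-Gorenstein projective dimension of `A` is at most `n`. -/
def GpdLE (S : Set (Triangle C)) (A : C) (n : ℕ) : Prop :=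
  FiniteRes S n (fun _ => GProjective S) A

set_option linter.unusedSectionVars false

lemma mk_distinguished_of_iso {X Y Z X' Y' Z' : C} {f : X ⟶ Y} {g : Y ⟶ Z}
    {h : Z ⟶ X⟦(1 : ℤ)⟧} {f' : X' ⟶ Y'} {g' : Y' ⟶ Z'} {h' : Z' ⟶ X'⟦(1 : ℤ)⟧}
    (hT : Triangle.mk f g h ∈ distTriang C) (a : X' ≅ X) (b : Y' ≅ Y) (c : Z' ≅ Z)
    (h₁ : f' ≫ b.hom = a.hom ≫ f) (h₂ : g' ≫ c.hom = b.hom ≫ g)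
    (h₃ : h' ≫ a.hom⟦(1 : ℤ)⟧' = c.hom ≫ h) : Triangle.mk f' g' h' ∈ distTriang C :=
  isomorphic_distinguished _ hT _ (Triangle.isoMk _ _ a b c h₁ h₂ h₃)

lemma distinguished_of_shift {X Y Z : C} (a : X ⟶ Y) (b : Y ⟶ Z) (c : Z ⟶ X⟦(1 : ℤ)⟧)
    (h : Triangle.mk (a⟦(1 : ℤ)⟧') (b⟦(1 : ℤ)⟧') (-c⟦(1 : ℤ)⟧') ∈ distTriang C) :
    Triangle.mk a b c ∈ distTriang C := by
  rw [rotate_distinguished_triangle, rotate_distinguished_triangle,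
    rotate_distinguished_triangle]
  change Triangle.mk (-a⟦(1 : ℤ)⟧') (-b⟦(1 : ℤ)⟧') (-c⟦(1 : ℤ)⟧') ∈ distTriang C
  exact mk_distinguished_of_iso h (Iso.refl _) ⟨-𝟙 _, -𝟙 _, by simp, by simp⟩ (Iso.refl _)
    (by simp) (by simp) (by simp)

/-- A morphism is `ξ`-phantom if it is annihilated by all maps from `ξ`-projectives. -/
def IsPhantom (S : Set (Triangle C)) {X Y : C} (h : X ⟶ Y) : Prop :=
  ∀ ⦃P : C⦄, XiProjective S P → ∀ φ : P ⟶ X, φ ≫ h = 0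

/-- There is a triangle `X ⟶ Y ⟶ Z ⟶ ΣX` in `S`. -/
def InTriangle (S : Set (Triangle C)) (X Y Z : C) : Prop :=
  ∃ (f : X ⟶ Y) (g : Y ⟶ Z) (h : Z ⟶ X⟦(1 : ℤ)⟧), Triangle.mk f g h ∈ S

/-- Every phantom map from `A` to a `ξ`-projective object vanishes. -/
def PhantomFree (S : Set (Triangle C)) (A : C) : Prop :=
  ∀ ⦃Q : C⦄, XiProjective S Q → ∀ φ : A ⟶ Q, IsPhantom S φ → φ = 0

section Phantom

variable {S : Set (Triangle C)}

lemma IsPhantom.comp {X Y Z : C} {h : X ⟶ Y} (hh : IsPhantom S h) (k : Y ⟶ Z) :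
    IsPhantom S (h ≫ k) := fun _ hP φ => by
  rw [← Category.assoc, hh hP, zero_comp]

lemma IsPhantom.precomp {X Y Z : C} {h : Y ⟶ Z} (hh : IsPhantom S h) (k : X ⟶ Y) :
    IsPhantom S (k ≫ h) := fun _ hP φ => by
  rw [← Category.assoc, hh hP]

lemma XiProjective.lift {P X Y Z : C} {f : X ⟶ Y} {g : Y ⟶ Z} {h : Z ⟶ X⟦(1 : ℤ)⟧}
    (hP : XiProjective S P) (hT : Triangle.mk f g h ∈ S) (φ : P ⟶ Z) :
    ∃ ψ : P ⟶ Y, ψ ≫ g = φ := (hP _ hT).2.2 φ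

lemma isPhantom_mor₃ (hS : IsProperClass S) {X Y Z : C} {f : X ⟶ Y} {g : Y ⟶ Z}
    {h : Z ⟶ X⟦(1 : ℤ)⟧} (hT : Triangle.mk f g h ∈ S) : IsPhantom S h := fun _ hP φ => by
  obtain ⟨ψ, rfl⟩ := hP.lift hT φ
  have : g ≫ h = 0 := comp_distTriang_mor_zero₂₃ _ (hS.subset_dist hT)
  rw [Category.assoc, this, comp_zero]

lemma isPhantom_of_lift {X Y Z : C} {f : X ⟶ Y} {g : Y ⟶ Z} {h : Z ⟶ X⟦(1 : ℤ)⟧}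
    (hT : Triangle.mk f g h ∈ distTriang C)
    (hl : ∀ ⦃P : C⦄, XiProjective S P → ∀ φ : P ⟶ Z, ∃ ψ : P ⟶ Y, ψ ≫ g = φ) :
    IsPhantom S h := fun _ hP φ => by
  obtain ⟨ψ, rfl⟩ := hl hP φ
  have : g ≫ h = 0 := comp_distTriang_mor_zero₂₃ _ hT
  rw [Category.assoc, this, comp_zero]

lemma comp_shift_mor₃_eq_zero (hS : IsProperClass S) {P : C}
    (hP : ∀ T ∈ S, ∀ φ : P ⟶ T.obj₃, φ ≫ T.mor₃ = 0) {T : Triangle C} (hT : T ∈ S) (n : ℤ)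
    (χ : P ⟶ T.obj₃⟦n⟧) : χ ≫ T.mor₃⟦n⟧' = 0 := by
  have h := hP _ (hS.susp_closed T hT n) χ
  have h' : χ ≫ (n.negOnePow • T.mor₃⟦n⟧' ≫ (shiftFunctorComm C 1 n).hom.app T.obj₁) = 0 := h
  rw [Linear.comp_units_smul, smul_eq_zero_iff_eq] at h'
  rw [← cancel_mono ((shiftFunctorComm C 1 n).hom.app T.obj₁), zero_comp, Category.assoc]
  exact h'

lemma xiProjective_iff (hS : IsProperClass S) {P : C} :
    XiProjective S P ↔ ∀ T ∈ S, ∀ φ : P ⟶ T.obj₃, φ ≫ T.mor₃ = 0 := by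
  refine ⟨fun hP T hT φ => isPhantom_mor₃ hS (f := T.mor₁) (g := T.mor₂) hT hP φ,
    fun hP T hT => ⟨?_, ?_, ?_⟩⟩
  · intro φ ψ hφψ
    have h0 : (φ - ψ) ≫ T.mor₁ = 0 := by
      rw [Preadditive.sub_comp]; exact sub_eq_zero.2 hφψ
    obtain ⟨χ, hχ⟩ : ∃ χ : P ⟶ T.obj₃⟦(-1 : ℤ)⟧, φ - ψ = χ ≫ T.invRotate.mor₁ :=
      Triangle.coyoneda_exact₂ _ (inv_rot_of_distTriang _ (hS.subset_dist hT)) _ h0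
    have h1 := comp_shift_mor₃_eq_zero hS hP hT (-1) χ
    have h2 : χ ≫ T.invRotate.mor₁ =
        χ ≫ (-T.mor₃⟦(-1 : ℤ)⟧' ≫ (shiftShiftNeg T.obj₁ (1 : ℤ)).hom) := rfl
    rw [← sub_eq_zero, hχ, h2, Preadditive.comp_neg, ← Category.assoc, h1, zero_comp, neg_zero]
  · intro φ hφ
    exact Triangle.coyoneda_exact₂ _ (hS.subset_dist hT) φ hφ
  · intro φ
    obtain ⟨ψ, hψ⟩ := Triangle.coyoneda_exact₃ _ (hS.subset_dist hT) φ (hP T hT φ)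
    exact ⟨ψ, hψ.symm⟩

lemma XiProjective.shift (hS : IsProperClass S) {P : C} (hP : XiProjective S P) :
    XiProjective S (P⟦(1 : ℤ)⟧) := by
  rw [xiProjective_iff hS] at hP ⊢
  intro T hT φ
  have h := comp_shift_mor₃_eq_zero hS hP hT (-1)
    ((shiftShiftNeg P (1 : ℤ)).inv ≫ φ⟦(-1 : ℤ)⟧')
  rw [Category.assoc, ← Functor.map_comp] at h
  apply (shiftFunctor C (-1 : ℤ)).map_injective
  rw [Functor.map_zero, ← cancel_epi (shiftShiftNeg P (1 : ℤ)).inv, comp_zero]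
  exact h

lemma xiProjective_zero (hS : IsProperClass S) {Z : C} (hZ : IsZero Z) : XiProjective S Z :=
  (xiProjective_iff hS).2 fun _ _ _ => hZ.eq_of_src _ _

lemma XiProjective.biprod (hS : IsProperClass S) {P Q : C} (hP : XiProjective S P)
    (hQ : XiProjective S Q) : XiProjective S (P ⊞ Q) := by
  rw [xiProjective_iff hS] at hP hQ ⊢
  intro T hT φ
  ext
  · rw [comp_zero, ← Category.assoc]; exact hP T hT _
  · rw [comp_zero, ← Category.assoc]; exact hQ T hT _

lemma XiProjective.of_iso (hS : IsProperClass S) {P Q : C} (hP : XiProjective S P)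
    (e : Q ≅ P) : XiProjective S Q := by
  rw [xiProjective_iff hS] at hP ⊢
  intro T hT φ
  rw [← cancel_epi e.inv, comp_zero, ← Category.assoc]
  exact hP T hT _

lemma mem_of_mor₃_eq_zero (hS : IsProperClass S) {X Y Z : C} {f : X ⟶ Y} {g : Y ⟶ Z}
    (hT : Triangle.mk f g (0 : Z ⟶ X⟦(1 : ℤ)⟧) ∈ distTriang C) :
    Triangle.mk f g (0 : Z ⟶ X⟦(1 : ℤ)⟧) ∈ S := by
  refine hS.split_mem _ hT ?_
  obtain ⟨e, h₁, h₂⟩ : ∃ e : Y ≅ X ⊞ Z, f ≫ e.hom = biprod.inl ∧ g = e.hom ≫ biprod.snd :=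
    exists_iso_binaryBiproduct_of_distTriang _ hT rfl
  exact ⟨Triangle.isoMk _ _ (Iso.refl X) e (Iso.refl Z)
    (show f ≫ e.hom = 𝟙 X ≫ biprod.inl by rw [h₁, Category.id_comp])
    (show g ≫ 𝟙 Z = e.hom ≫ biprod.snd by rw [h₂, Category.comp_id])
    (show (0 : Z ⟶ X⟦(1 : ℤ)⟧) ≫ (𝟙 X)⟦(1 : ℤ)⟧' = 𝟙 Z ≫ 0 by rw [zero_comp, comp_zero])⟩

lemma inTriangle_swap_of_mor₃_eq_zero (hS : IsProperClass S) {X Y Z : C} {f : X ⟶ Y}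
    {g : Y ⟶ Z} (hT : Triangle.mk f g (0 : Z ⟶ X⟦(1 : ℤ)⟧) ∈ distTriang C) :
    InTriangle S Z Y X ∧ Nonempty (Y ≅ X ⊞ Z) := by
  obtain ⟨e, -, -⟩ : ∃ e : Y ≅ X ⊞ Z, f ≫ e.hom = biprod.inl ∧ g = e.hom ≫ biprod.snd :=
    exists_iso_binaryBiproduct_of_distTriang _ hT rfl
  refine ⟨⟨biprod.inr ≫ e.inv, e.hom ≫ biprod.fst, 0, mem_of_mor₃_eq_zero hS ?_⟩, ⟨e⟩⟩
  exact mk_distinguished_of_iso (binaryBiproductTriangle_distinguished Z X)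
    (Iso.refl Z) (e ≪≫ biprod.braiding X Z) (Iso.refl X) (by ext <;> simp) (by simp) (by simp)

lemma InTriangle.swap_of_xiProjective (hS : IsProperClass S) {X Y Z : C}
    (hT : InTriangle S X Y Z) (hZ : XiProjective S Z) :
    InTriangle S Z Y X ∧ Nonempty (Y ≅ X ⊞ Z) := by
  obtain ⟨f, g, h, hT⟩ := hT
  obtain rfl : h = 0 := by simpa using isPhantom_mor₃ hS hT hZ (𝟙 _)
  exact inTriangle_swap_of_mor₃_eq_zero hS (hS.subset_dist hT)

lemma InTriangle.swap_of_phantomFree (hS : IsProperClass S) {X Y Z : C}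
    (hT : InTriangle S X Y Z) (hX : XiProjective S X) (hZ : PhantomFree S Z) :
    InTriangle S Z Y X := by
  obtain ⟨f, g, h, hT⟩ := hT
  obtain rfl : h = 0 := hZ (hX.shift hS) h (isPhantom_mor₃ hS hT)
  exact (inTriangle_swap_of_mor₃_eq_zero hS (hS.subset_dist hT)).1

lemma XiProjective.of_inTriangle (hS : IsProperClass S) {X Y Z : C}
    (hT : InTriangle S X Y Z) (hX : XiProjective S X) (hZ : XiProjective S Z) :
    XiProjective S Y := by
  obtain ⟨-, ⟨e⟩⟩ := hT.swap_of_xiProjective hS hZ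
  exact (hX.biprod hS hZ).of_iso hS e

lemma inTriangle_of_isZero_left (hS : IsProperClass S) {Z : C} (hZ : IsZero Z) (X : C) :
    InTriangle S Z X X :=
  ⟨0, 𝟙 X, 0, mem_of_mor₃_eq_zero hS
    (mk_distinguished_of_iso (contractible_distinguished₁ X) hZ.isoZero (Iso.refl X) (Iso.refl X)
      (by simp) (by simp) (by simp))⟩

lemma inTriangle_of_isZero_right (hS : IsProperClass S) {Z : C} (hZ : IsZero Z) (X : C) :
    InTriangle S X X Z :=
  ⟨𝟙 X, 0, 0, mem_of_mor₃_eq_zero hS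
    (mk_distinguished_of_iso (contractible_distinguished X) (Iso.refl X) (Iso.refl X) hZ.isoZero
      (by simp) (by simp) (by simp))⟩

lemma PhantomFree.of_inTriangle {X Y Z : C} (hS : IsProperClass S)
    (hT : InTriangle S X Y Z) (hX : PhantomFree S X) (hZ : PhantomFree S Z) :
    PhantomFree S Y := by
  obtain ⟨f, g, h, hT⟩ := hT
  intro Q hQ φ hφ
  obtain ⟨ψ, rfl⟩ : ∃ ψ : Z ⟶ Q, φ = g ≫ ψ := Triangle.yoneda_exact₂ _ (hS.subset_dist hT) φ
    (hX hQ _ (hφ.precomp f))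
  have : IsPhantom S ψ := fun P hP χ => by
    obtain ⟨χ, rfl⟩ := hP.lift hT χ
    rw [Category.assoc]
    exact hφ hP χ
  rw [hZ hQ ψ this, comp_zero]

lemma XiProjective.phantomFree {P : C} (hP : XiProjective S P) : PhantomFree S P :=
  fun _ _ φ hφ => by simpa using hφ hP (𝟙 _)

lemma PhantomFree.contraExact (hS : IsProperClass S) {T : Triangle C} (hT : T ∈ S)
    (hW : PhantomFree S T.obj₃) {Q : C} (hQ : XiProjective S Q) : ContraExact T Q := by
  have hd := hS.subset_dist hT
  refine ⟨?_, ?_, ?_⟩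
  · intro φ ψ hφψ
    rw [← sub_eq_zero]
    refine hW hQ _ fun P hP χ => ?_
    obtain ⟨χ, rfl⟩ : ∃ χ' : P ⟶ T.obj₂, χ' ≫ T.mor₂ = χ := (hP T hT).2.2 χ
    have : T.mor₂ ≫ (φ - ψ) = 0 := by rw [Preadditive.comp_sub]; exact sub_eq_zero.2 hφψ
    rw [Category.assoc, this, comp_zero]
  · exact fun φ hφ => Triangle.yoneda_exact₂ _ hd φ hφ
  · intro φ
    have h0 : T.mor₃ ≫ φ⟦(1 : ℤ)⟧' = 0 :=
      hW (hQ.shift hS) _ (IsPhantom.comp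
        (isPhantom_mor₃ hS (f := T.mor₁) (g := T.mor₂) hT) _)
    obtain ⟨χ, hχ⟩ : ∃ χ : T.obj₂⟦(1 : ℤ)⟧ ⟶ Q⟦(1 : ℤ)⟧,
        φ⟦(1 : ℤ)⟧' = (-T.mor₁⟦(1 : ℤ)⟧') ≫ χ :=
      Triangle.yoneda_exact₂ _ (rot_of_distTriang _ (rot_of_distTriang _ hd)) _ h0
    refine ⟨-(shiftFunctor C (1 : ℤ)).preimage χ, ?_⟩
    apply (shiftFunctor C (1 : ℤ)).map_injective
    simp [hχ]

/-- A description of `ξ`-Gorenstein projectives by means of `InTriangle`. -/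
lemma gProjective_iff (hS : IsProperClass S) {A : C} :
    GProjective S A ↔ ∃ K : ℤ → C, K 0 = A ∧ ∀ n, PhantomFree S (K n) ∧
      ∃ P, XiProjective S P ∧ InTriangle S (K (n + 1)) P (K n) := by
  constructor
  · rintro ⟨K, P, f, g, h, h0, hK⟩
    refine ⟨K, h0, fun n => ⟨fun Q hQ φ hφ => ?_, P n, (hK n).1, _, _, _, (hK n).2.1⟩⟩
    refine ((hK n).2.2 Q hQ).1 ?_
    exact (hφ (hK n).1 (g n)).trans comp_zero.symm
  · rintro ⟨K, h0, hK⟩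
    choose hW P hP f g h hT using hK
    exact ⟨K, P, f, g, h, h0, fun n => ⟨hP n, hT n, fun Q hQ =>
      PhantomFree.contraExact hS (hT n) (hW n) hQ⟩⟩

lemma GProjective.phantomFree (hS : IsProperClass S) {A : C} (hA : GProjective S A) :
    PhantomFree S A := by
  obtain ⟨K, rfl, hK⟩ := (gProjective_iff hS).1 hA
  exact (hK 0).1

lemma GProjective.exists_syzygy (hS : IsProperClass S) {A : C} (hA : GProjective S A) :
    ∃ K P, GProjective S K ∧ XiProjective S P ∧ InTriangle S K P A := by
  obtain ⟨K, rfl, hK⟩ := (gProjective_iff hS).1 hA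
  obtain ⟨P, hP, hT⟩ := (hK 0).2
  exact ⟨K (0 + 1), P, (gProjective_iff hS).2
    ⟨fun n => K (n + 1), rfl, fun n => hK (n + 1)⟩, hP, hT⟩

lemma GProjective.exists_cosyzygy (hS : IsProperClass S) {A : C} (hA : GProjective S A) :
    ∃ N P, GProjective S N ∧ XiProjective S P ∧ InTriangle S A P N := by
  obtain ⟨K, rfl, hK⟩ := (gProjective_iff hS).1 hA
  obtain ⟨P, hP, hT⟩ := (hK (-1)).2
  refine ⟨K (-1), P, (gProjective_iff hS).2 ⟨fun n => K (n - 1), rfl, fun n => ?_⟩, hP, hT⟩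
  simpa only [sub_add_cancel, add_sub_cancel_right] using hK (n - 1)

/-- A coinduction principle for `ξ`-Gorenstein projectives. -/
lemma gProjective_of_coinduction (hS : IsProperClass S) (Z : C → Prop)
    (hW : ∀ A, Z A → PhantomFree S A)
    (hl : ∀ A, Z A → ∃ K, Z K ∧ ∃ P, XiProjective S P ∧ InTriangle S K P A)
    (hr : ∀ A, Z A → ∃ N, Z N ∧ ∃ P, XiProjective S P ∧ InTriangle S A P N)
    {A : C} (hA : Z A) : GProjective S A := by
  choose l hl hl' using hl
  choose r hr hr' using hr
  let L : {A // Z A} → {A // Z A} := fun A => ⟨l A.1 A.2, hl A.1 A.2⟩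
  let R : {A // Z A} → {A // Z A} := fun A => ⟨r A.1 A.2, hr A.1 A.2⟩
  let u : ℕ → {A // Z A} := fun n => Nat.rec ⟨A, hA⟩ (fun _ => L) n
  let v : ℕ → {A // Z A} := fun n => Nat.rec (R ⟨A, hA⟩) (fun _ => R) n
  let K : ℤ → {A // Z A} := fun n => Int.rec u v n
  refine (gProjective_iff hS).2 ⟨fun n => (K n).1, rfl, fun n => ⟨hW _ (K n).2, ?_⟩⟩
  match n with
  | Int.ofNat n => exact hl' (u n).1 (u n).2
  | Int.negSucc 0 => exact hr' A hA
  | Int.negSucc (n + 1) => exact hr' (v n).1 (v n).2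

lemma XiProjective.gProjective (hS : IsProperClass S) {P : C} (hP : XiProjective S P) :
    GProjective S P :=
  gProjective_of_coinduction hS (XiProjective S) (fun _ h => h.phantomFree)
    (fun A hA => ⟨_, xiProjective_zero hS (isZero_zero C), A, hA,
      inTriangle_of_isZero_left hS (isZero_zero C) A⟩)
    (fun A hA => ⟨_, xiProjective_zero hS (isZero_zero C), A, hA,
      inTriangle_of_isZero_right hS (isZero_zero C) A⟩) hP

end Phantom

variable [IsTriangulated C]

section Triangulated

variable {S : Set (Triangle C)}

/-- The homotopy pullback of a distinguished triangle along the third morphism of another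
one. -/
lemma exists_homotopy_pullback {A B D K P : C} {u : A ⟶ B} {v : B ⟶ D}
    {h : D ⟶ A⟦(1 : ℤ)⟧} (hT : Triangle.mk u v h ∈ distTriang C) {δ : K ⟶ P} {ε : P ⟶ D}
    {ζ : D ⟶ K⟦(1 : ℤ)⟧} (hT' : Triangle.mk δ ε ζ ∈ distTriang C) :
    ∃ (G : C) (α : K ⟶ G) (β : G ⟶ B) (f : A ⟶ G) (g : G ⟶ P),
      Triangle.mk α β (v ≫ ζ) ∈ distTriang C ∧ Triangle.mk f g (ε ≫ h) ∈ distTriang C ∧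
      α ≫ g = δ ∧ f ≫ β = u ∧ g ≫ ε = β ≫ v := by
  obtain ⟨G, α, β, hG⟩ := distinguished_cocone_triangle₂ (v ≫ ζ)
  have h₁₂ : Triangle.mk v h (-u⟦(1 : ℤ)⟧') ∈ distTriang C := rot_of_distTriang _ hT
  have h₂₃ : Triangle.mk ζ (-δ⟦(1 : ℤ)⟧') (-ε⟦(1 : ℤ)⟧') ∈ distTriang C :=
    rot_of_distTriang _ (rot_of_distTriang _ hT')
  have h₁₃ : Triangle.mk (v ≫ ζ) (-α⟦(1 : ℤ)⟧') (-β⟦(1 : ℤ)⟧') ∈ distTriang C :=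
    rot_of_distTriang _ (rot_of_distTriang _ hG)
  have O := Triangulated.someOctahedron rfl h₁₂ h₂₃ h₁₃
  obtain ⟨m₁, m₃, c₁, c₂, c₃, c₄, hm⟩ := O
  obtain ⟨f, rfl⟩ := (shiftFunctor C (1 : ℤ)).map_surjective m₁
  obtain ⟨g, rfl⟩ := (shiftFunctor C (1 : ℤ)).map_surjective m₃
  refine ⟨G, α, β, f, g, hG, distinguished_of_shift _ _ _ ?_, ?_, ?_, ?_⟩
  · simpa using hm
  · apply (shiftFunctor C (1 : ℤ)).map_injective
    simpa using c₃
  · apply (shiftFunctor C (1 : ℤ)).map_injective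
    simpa using c₂
  · apply (shiftFunctor C (1 : ℤ)).map_injective
    simpa using c₄.symm

/-- With enough `ξ`-projectives, `ξ` consists of the distinguished triangles whose third
morphism is phantom. -/
lemma mem_of_isPhantom (hS : IsProperClass S) (hE : HasEnoughXiProjectives S) {X Y Z : C}
    {f : X ⟶ Y} {g : Y ⟶ Z} {h : Z ⟶ X⟦(1 : ℤ)⟧} (hT : Triangle.mk f g h ∈ distTriang C)
    (hh : IsPhantom S h) : Triangle.mk f g h ∈ S := by
  obtain ⟨K, P, δ, ε, ζ, hP, hT'⟩ := hE Z
  obtain ⟨G, α, β, f', g', h₁, h₂, c₁, c₂, c₃⟩ :=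
    exists_homotopy_pullback hT (hS.subset_dist hT')
  rw [hh hP ε] at h₂
  exact hS.saturated _ hT K G P α δ f' g' 0 β ε (g ≫ ζ) ζ h₁ (mem_of_mor₃_eq_zero hS h₂) hT'
    c₁ c₂ c₃ (hh hP ε).symm rfl

lemma InTriangle.pullback (hS : IsProperClass S) (hE : HasEnoughXiProjectives S)
    {A B D K P : C} (hT : InTriangle S A B D) (hT' : InTriangle S K P D) :
    ∃ G, InTriangle S A G P ∧ InTriangle S K G B := by
  obtain ⟨u, v, h, hT⟩ := hT
  obtain ⟨δ, ε, ζ, hT'⟩ := hT'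
  obtain ⟨G, α, β, f, g, h₁, h₂, -⟩ :=
    exists_homotopy_pullback (hS.subset_dist hT) (hS.subset_dist hT')
  exact ⟨G, ⟨f, g, _, mem_of_isPhantom hS hE h₂ ((isPhantom_mor₃ hS hT).precomp ε)⟩,
    ⟨α, β, _, mem_of_isPhantom hS hE h₁ ((isPhantom_mor₃ hS hT').precomp v)⟩⟩

lemma InTriangle.pushout (hS : IsProperClass S) (hE : HasEnoughXiProjectives S)
    {K L N G A : C} (hT : InTriangle S K L N) (hT' : InTriangle S K G A) :
    ∃ H, InTriangle S L H A ∧ InTriangle S G H N := by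
  obtain ⟨a, b, c, hT⟩ := hT
  obtain ⟨a', b', c', hT'⟩ := hT'
  obtain ⟨H, i, p, hH⟩ := distinguished_cocone_triangle₂ (c' ≫ a⟦(1 : ℤ)⟧')
  have hd' := hS.subset_dist hT'
  have hd := hS.subset_dist hT
  have h₁₂ : Triangle.mk c' (-a'⟦(1 : ℤ)⟧') (-b'⟦(1 : ℤ)⟧') ∈ distTriang C :=
    rot_of_distTriang _ (rot_of_distTriang _ hd')
  have h₂₃ : Triangle.mk (a⟦(1 : ℤ)⟧') (b⟦(1 : ℤ)⟧') (-c⟦(1 : ℤ)⟧') ∈ distTriang C := by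
    have hd₃ : Triangle.mk (-a⟦(1 : ℤ)⟧') (-b⟦(1 : ℤ)⟧') (-c⟦(1 : ℤ)⟧') ∈ distTriang C :=
      rot_of_distTriang _ (rot_of_distTriang _ (rot_of_distTriang _ hd))
    exact mk_distinguished_of_iso hd₃ (Iso.refl _) ⟨-𝟙 _, -𝟙 _, by simp, by simp⟩ (Iso.refl _)
      (by simp) (by simp) (by simp)
  have h₁₃ : Triangle.mk (c' ≫ a⟦(1 : ℤ)⟧') (-i⟦(1 : ℤ)⟧') (-p⟦(1 : ℤ)⟧') ∈ distTriang C :=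
    rot_of_distTriang _ (rot_of_distTriang _ hH)
  obtain ⟨m₁, m₃, -, -, -, -, hm⟩ := Triangulated.someOctahedron rfl h₁₂ h₂₃ h₁₃
  obtain ⟨f, rfl⟩ := (shiftFunctor C (1 : ℤ)).map_surjective m₁
  obtain ⟨g, rfl⟩ := (shiftFunctor C (1 : ℤ)).map_surjective m₃
  have hd₂ : Triangle.mk f g (-(c ≫ a'⟦(1 : ℤ)⟧')) ∈ distTriang C :=
    distinguished_of_shift _ _ _ (by simpa using hm)
  refine ⟨H, ⟨i, p, _, mem_of_isPhantom hS hE hH ((isPhantom_mor₃ hS hT').comp _)⟩,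
    ⟨f, g, _, mem_of_isPhantom hS hE hd₂ ?_⟩⟩
  rw [← Preadditive.comp_neg]
  exact (isPhantom_mor₃ hS hT).comp _

lemma InTriangle.comp_epi (hS : IsProperClass S) (hE : HasEnoughXiProjectives S)
    {K G A M Q : C} (hT : InTriangle S K G A) (hT' : InTriangle S M Q G) :
    ∃ L, InTriangle S L Q A ∧ InTriangle S M L K := by
  obtain ⟨i, p, h, hT⟩ := hT
  obtain ⟨j, q, k, hT'⟩ := hT'
  obtain ⟨L, a, b, hL⟩ := distinguished_cocone_triangle₂ (i ≫ k)
  have h₂₃ : Triangle.mk k (-j⟦(1 : ℤ)⟧') (-q⟦(1 : ℤ)⟧') ∈ distTriang C :=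
    rot_of_distTriang _ (rot_of_distTriang _ (hS.subset_dist hT'))
  have h₁₃ : Triangle.mk (i ≫ k) (-a⟦(1 : ℤ)⟧') (-b⟦(1 : ℤ)⟧') ∈ distTriang C :=
    rot_of_distTriang _ (rot_of_distTriang _ hL)
  obtain ⟨m₁, m₃, -, -, -, -, hm⟩ :=
    Triangulated.someOctahedron rfl (hS.subset_dist hT) h₂₃ h₁₃
  obtain ⟨g, hg⟩ := (shiftFunctor C (1 : ℤ)).map_surjective (-m₃)
  obtain rfl : m₃ = -g⟦(1 : ℤ)⟧' := by rw [hg, neg_neg]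
  have hd : Triangle.mk g (q ≫ p) m₁ ∈ distTriang C := by
    rw [rotate_distinguished_triangle, rotate_distinguished_triangle]
    change Triangle.mk m₁ (-g⟦(1 : ℤ)⟧') (-(q ≫ p)⟦(1 : ℤ)⟧') ∈ distTriang C
    simpa using hm
  refine ⟨L, ⟨g, q ≫ p, m₁, mem_of_isPhantom hS hE hd (isPhantom_of_lift hd fun P hP φ => ?_)⟩,
    ⟨a, b, _, mem_of_isPhantom hS hE hL ((isPhantom_mor₃ hS hT').precomp i)⟩⟩
  obtain ⟨ψ, rfl⟩ := hP.lift hT φ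
  obtain ⟨χ, rfl⟩ := hP.lift hT' ψ
  exact ⟨χ, (Category.assoc _ _ _).symm⟩

lemma InTriangle.comp_mono (hS : IsProperClass S) (hE : HasEnoughXiProjectives S)
    {K G A P N : C} (hT : InTriangle S K G A) (hT' : InTriangle S G P N) :
    ∃ L, InTriangle S K P L ∧ InTriangle S A L N := by
  obtain ⟨i, p, h, hT⟩ := hT
  obtain ⟨j, q, k, hT'⟩ := hT'
  obtain ⟨L, a, b, hL⟩ := distinguished_cocone_triangle (i ≫ j)
  obtain ⟨m₁, m₃, -, c₂, -, c₄, hm⟩ :=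
    Triangulated.someOctahedron rfl (hS.subset_dist hT) (hS.subset_dist hT') hL
  refine ⟨L, ⟨_, a, b, mem_of_isPhantom hS hE hL fun R hR φ => ?_⟩,
    ⟨m₁, m₃, _, mem_of_isPhantom hS hE hm ((isPhantom_mor₃ hS hT').comp _)⟩⟩
  have h0 : (φ ≫ b) ≫ i⟦(1 : ℤ)⟧' = 0 := by
    rw [Category.assoc, c₄]
    exact (isPhantom_mor₃ hS hT').precomp m₃ hR φ
  obtain ⟨χ, hχ⟩ : ∃ χ : R ⟶ A, φ ≫ b = χ ≫ h :=
    Triangle.coyoneda_exact₁ _ (hS.subset_dist hT) _ h0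
  rw [hχ]
  exact isPhantom_mor₃ hS hT hR χ

/-- `ξ`-Gorenstein projectives are closed under extensions along triangles in `ξ`. -/
lemma GProjective.of_inTriangle (hS : IsProperClass S) (hE : HasEnoughXiProjectives S)
    {X Y Z : C} (hT : InTriangle S X Y Z) (hX : GProjective S X) (hZ : GProjective S Z) :
    GProjective S Y := by
  refine gProjective_of_coinduction hS
    (fun B => ∃ A D, GProjective S A ∧ GProjective S D ∧ InTriangle S A B D)
    ?_ ?_ ?_ ⟨X, Z, hX, hZ, hT⟩
  · rintro B ⟨A, D, hA, hD, hT⟩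
    exact PhantomFree.of_inTriangle hS hT (hA.phantomFree hS) (hD.phantomFree hS)
  · rintro B ⟨A, D, hA, hD, hT⟩
    obtain ⟨A', P, hA', hP, hAP⟩ := hA.exists_syzygy hS
    obtain ⟨D', Q, hD', hQ, hDQ⟩ := hD.exists_syzygy hS
    obtain ⟨G, hG, hG'⟩ := hT.pullback hS hE hDQ
    obtain ⟨R, hR, hR'⟩ := (hG.swap_of_xiProjective hS hQ).1.pullback hS hE hAP
    obtain ⟨K, hK, hK'⟩ := hG'.comp_epi hS hE hR'
    exact ⟨K, ⟨A', D', hA', hD', hK'⟩, R, hQ.of_inTriangle hS hR hP, hK⟩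
  · rintro B ⟨A, D, hA, hD, hT⟩
    obtain ⟨A', P, hA', hP, hAP⟩ := hA.exists_cosyzygy hS
    obtain ⟨D', Q, hD', hQ, hDQ⟩ := hD.exists_cosyzygy hS
    obtain ⟨G, hG, hG'⟩ := hAP.pushout hS hE hT
    obtain ⟨R, hR, hR'⟩ :=
      (hG.swap_of_phantomFree hS hP (hD.phantomFree hS)).pushout hS hE hDQ
    obtain ⟨N, hN, hN'⟩ := hG'.comp_mono hS hE hR
    exact ⟨N, ⟨A', D', hA', hD', hN'⟩, R, hQ.of_inTriangle hS hR' hP, hN⟩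

/-- In a two-step sequence of `ξ`-Gorenstein projectives, the left one can be replaced by a
`ξ`-projective. -/
lemma exists_xiProjective_left (hS : IsProperClass S) (hE : HasEnoughXiProjectives S)
    {K G₁ K₁ G₀ A : C} (h₁ : InTriangle S K G₁ K₁) (h₀ : InTriangle S K₁ G₀ A)
    (hG₁ : GProjective S G₁) (hG₀ : GProjective S G₀) :
    ∃ P L G, XiProjective S P ∧ GProjective S G ∧ InTriangle S K P L ∧ InTriangle S L G A := by
  obtain ⟨N, P, hN, hP, hT⟩ := hG₁.exists_cosyzygy hS
  obtain ⟨L, hL, hL'⟩ := h₁.comp_mono hS hE hT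
  obtain ⟨G, hG, hG'⟩ := hL'.pushout hS hE h₀
  exact ⟨P, L, G, hP, .of_inTriangle hS hE hG' hG₀ hN, hL, hG⟩

/-- In a two-step sequence of `ξ`-Gorenstein projectives, the right one can be replaced by a
`ξ`-projective. -/
lemma exists_xiProjective_right (hS : IsProperClass S) (hE : HasEnoughXiProjectives S)
    {K G₁ K₁ G₀ A : C} (h₁ : InTriangle S K G₁ K₁) (h₀ : InTriangle S K₁ G₀ A)
    (hG₁ : GProjective S G₁) (hG₀ : GProjective S G₀) :
    ∃ P L G, XiProjective S P ∧ GProjective S G ∧ InTriangle S K G L ∧ InTriangle S L P A := by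
  obtain ⟨M, P, hM, hP, hT⟩ := hG₀.exists_syzygy hS
  obtain ⟨L, hL, hL'⟩ := h₀.comp_epi hS hE hT
  obtain ⟨G, hG, hG'⟩ := hL'.pullback hS hE h₁
  exact ⟨P, L, G, hP, .of_inTriangle hS hE hG hM hG₁, hG', hL⟩

/-- A recursive version of `FiniteRes`, with `n` terms. -/
def RecRes (S : Set (Triangle C)) : ℕ → (ℕ → C → Prop) → C → Prop
  | 0, _, A => IsZero A
  | n + 1, X, A => ∃ K G, X 0 G ∧ InTriangle S K G A ∧ RecRes S n (fun j => X (j + 1)) K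

lemma RecRes.mono {n : ℕ} {X Y : ℕ → C → Prop} (h : ∀ j B, X j B → Y j B) {A : C}
    (hA : RecRes S n X A) : RecRes S n Y A := by
  induction n generalizing X Y A with
  | zero => exact hA
  | succ n ih =>
    obtain ⟨K, G, hG, hT, hK⟩ := hA
    exact ⟨K, G, h _ _ hG, hT, ih (fun j => h (j + 1)) hK⟩

lemma recRes_iff {n : ℕ} {X : ℕ → C → Prop} {A : C} :
    RecRes S n X A ↔ ∃ K : ℕ → C, K 0 = A ∧ IsZero (K n) ∧
      ∀ j < n, ∃ G, X j G ∧ InTriangle S (K (j + 1)) G (K j) := by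
  induction n generalizing X A with
  | zero => exact ⟨fun h => ⟨fun _ => A, rfl, h, by simp⟩, fun ⟨K, h, hK, _⟩ => h ▸ hK⟩
  | succ n ih =>
    constructor
    · rintro ⟨K', G, hG, hT, hK'⟩
      obtain ⟨K, rfl, hz, hK⟩ := ih.1 hK'
      refine ⟨fun j => Nat.casesOn j A K, rfl, hz, fun j hj => ?_⟩
      match j with
      | 0 => exact ⟨G, hG, hT⟩
      | j + 1 => exact hK j (by lia)
    · rintro ⟨K, rfl, hz, hK⟩
      obtain ⟨G, hG, hT⟩ := hK 0 (by lia)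
      exact ⟨K 1, G, hG, hT, ih.2 ⟨fun j => K (j + 1), rfl, hz, fun j hj => hK (j + 1) (by lia)⟩⟩

lemma finiteRes_iff_recRes {n : ℕ} {X : ℕ → C → Prop} {A : C} :
    FiniteRes S n X A ↔ RecRes S (n + 1) X A := by
  rw [recRes_iff]
  constructor
  · rintro ⟨K, G, f, g, h, h0, hz, hK⟩
    exact ⟨K, h0, hz, fun j hj =>
      ⟨G j, (hK j (by lia)).1, f j, g j, h j, (hK j (by lia)).2⟩⟩
  · rintro ⟨K, h0, hz, hK⟩
    have hK' (j : ℕ) : ∃ (G : C) (f : K (j + 1) ⟶ G) (g : G ⟶ K j)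
        (h : K j ⟶ (K (j + 1))⟦(1 : ℤ)⟧), j ≤ n → X j G ∧ Triangle.mk f g h ∈ S := by
      by_cases hj : j ≤ n
      · obtain ⟨G, hG, f, g, h, hT⟩ := hK j (by lia)
        exact ⟨G, f, g, h, fun _ => ⟨hG, hT⟩⟩
      · exact ⟨K j, 0, 0, 0, fun h => (hj h).elim⟩
    choose G f g h hT using hK'
    exact ⟨K, G, f, g, h, h0, hz, hT⟩

lemma RecRes.exists_single_gProjective (hS : IsProperClass S) (hE : HasEnoughXiProjectives S)
    {n : ℕ} {A : C} (hA : RecRes S (n + 1) (fun _ => GProjective S) A) {i : ℕ} (hi : i ≤ n) :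
    RecRes S (n + 1) (fun j => if j = i then GProjective S else XiProjective S) A := by
  induction n generalizing A i with
  | zero =>
    obtain rfl : i = 0 := by lia
    exact hA
  | succ n ih =>
    obtain ⟨K₁, G₀, hG₀, h₀, hK₁⟩ := hA
    match i with
    | 0 =>
      obtain ⟨K, G₁, hG₁, h₁, hK⟩ := ih hK₁ (Nat.zero_le n)
      obtain ⟨P, L, G, hP, hG, hL, hT⟩ := exists_xiProjective_left hS hE h₁ h₀ hG₁ hG₀
      exact ⟨L, G, hG, hT, K, P, hP, hL, hK.mono fun j B => by simp⟩
    | i + 1 =>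
      obtain ⟨K, G₁, hG₁, h₁, hK⟩ := hK₁
      obtain ⟨P, L, G, hP, hG, hL, hT⟩ := exists_xiProjective_right hS hE h₁ h₀ hG₁ hG₀
      refine ⟨L, P, hP, hT, ?_⟩
      have hL' : RecRes S (n + 1) (fun _ => GProjective S) L := ⟨K, G, hG, hL, hK⟩
      exact (ih hL' (i := i) (by lia)).mono fun j B => by simp

end Triangulated


theorem gpdLE_iff_proj_except_one_gproj (S : Set (Triangle C))
    (hS : IsProperClass S) (hE : HasEnoughXiProjectives S) (A : C) (n : ℕ) :
    GpdLE S A n ↔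
      ∀ i ≤ n, FiniteRes S n
        (fun j => if j = i then GProjective S else XiProjective S) A := by
  constructor
  · intro hA i hi
    exact finiteRes_iff_recRes.2
      ((finiteRes_iff_recRes.1 hA).exists_single_gProjective hS hE hi)
  · intro h
    refine finiteRes_iff_recRes.2 ((finiteRes_iff_recRes.1 (h 0 (Nat.zero_le n))).mono ?_)
    intro j B hB
    split_ifs at hB
    exacts [hB, hB.gProjective hS]

end GorensteinTriangulated
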